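/- Let (R, 𝔪) be an unmixed Noetherian local ring of dimension d ≥ 2 with infinite residue field. Then for every integer n there exists a parameter ideal 𝔮 ⊆ 𝔪ⁿ such that e₁(𝔮:𝔪) ≤ f₀(𝔮). -/

import Mathlib

open CategoryTheory IsLocalRing

noncomputable section

/-- The length of a module, defined as the Krull dimension of its submodule lattice. -/
def moduleLength (R M : Type) [CommRing R] [AddCommGroup M] [Module R M] : WithBot ℕ∞ :=
  Order.krullDim (Submodule R M)

variable (R : Type) [CommRing R] [IsLocalRing R]

/-- `q` is a parameter ideal of the `d`-dimensional local ring `R`: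
it is generated by `d` elements and is `𝔪`-primary (its radical is `𝔪`). -/
def IsParameterIdeal (d : ℕ) (q : Ideal R) : Prop :=
  (∃ x : Fin d → R, q = Ideal.span (Set.range x)) ∧ q.radical = maximalIdeal R

/-- `e` is the sequence of Hilbert coefficients of the `𝔪`-primary ideal `I`:
for all large `n`, `ℓ(R/Iⁿ⁺¹) = Σ_{i=0}^d (-1)^i e_i C(n+d-i, d-i)`. -/
def IsHilbertCoeffs (d : ℕ) (I : Ideal R) (e : ℕ → ℤ) : Prop :=
  ∃ N : ℕ, ∀ n ≥ N, ∃ L : ℕ,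
    moduleLength R (R ⧸ I ^ (n + 1)) = (L : ℕ∞) ∧
    (L : ℤ) = ∑ i ∈ Finset.range (d + 1),
      (-1 : ℤ) ^ i * e i * ((n + d - i).choose (d - i) : ℤ)

/-- The index of reducibility `𝒩(q;R) = ℓ_R((q :_R 𝔪)/q)`. -/
def indexOfReducibility (q : Ideal R) : WithBot ℕ∞ :=
  moduleLength R
    (↥(q.colon (maximalIdeal R)) ⧸ (Submodule.comap (q.colon (maximalIdeal R)).subtype q))

/-- `R` is unmixed of dimension `d`: `dim (R̂/P) = d` for every associated prime `P`
of the `𝔪`-adic completion `R̂` of `R`. -/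
def IsUnmixed (d : ℕ) : Prop :=
  ∀ P ∈ associatedPrimes (AdicCompletion (maximalIdeal R) R) (AdicCompletion (maximalIdeal R) R),
    ringKrullDim ((AdicCompletion (maximalIdeal R) R) ⧸ P) = (d : WithBot ℕ∞)

/-- The depth of a local ring `A`, as the least `i` such that `Ext^i(k, A) ≠ 0`. -/
def extDepth (A : Type) [CommRing A] [IsLocalRing A] : ℕ∞ :=
  sInf {n : ℕ∞ | ∃ m : ℕ, n = (m : ℕ∞) ∧
    Nontrivial (((Ext A (ModuleCat A) m).obj
      (Opposite.op (ModuleCat.of A (ResidueField A)))).obj (ModuleCat.of A A))}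

/-- A local ring is Cohen–Macaulay if its depth equals its Krull dimension. -/
def IsCohenMacaulay (A : Type) [CommRing A] [IsLocalRing A] : Prop :=
  (extDepth A : WithBot ℕ∞) = ringKrullDim A

/-- The Cohen–Macaulay type `r(R) = ℓ_R(Ext^d_R(R/𝔪, R))`. -/
def cmType (d : ℕ) : WithBot ℕ∞ :=
  moduleLength R (((Ext R (ModuleCat R) d).obj
      (Opposite.op (ModuleCat.of R (R ⧸ maximalIdeal R)))).obj (ModuleCat.of R R))

/-- `f` is the sequence of coefficients of the polynomial that agrees with
`n ↦ ℓ((Iⁿ :_R 𝔪)/Iⁿ)` for all large `n`; `f 0` is the irreducible multiplicity `f₀(I)`. -/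
def IsIrrCoeffs (d : ℕ) (I : Ideal R) (f : ℕ → ℤ) : Prop :=
  ∃ N : ℕ, ∀ n ≥ N, ∃ L : ℕ,
    indexOfReducibility R (I ^ n) = (L : ℕ∞) ∧
    (L : ℤ) = ∑ i ∈ Finset.range d,
      (-1 : ℤ) ^ i * f i * ((n + (d - 1) - i).choose (d - 1 - i) : ℤ)

/-- `R` is a generalized Cohen–Macaulay ring of dimension `d`:
the local cohomology modules `H^i_𝔪(R)` have finite length for all `i < d`. -/
def IsGeneralizedCM (d : ℕ) : Prop :=
  ∀ i < d, ∃ L : ℕ,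
    moduleLength R ↥((localCohomology (maximalIdeal R) i).obj (ModuleCat.of R R)) = (L : ℕ∞)

/-- `r_i(R) = dim_k ((0) :_{H^i_𝔪(R)} 𝔪)`, the length of the socle of the `i`-th
local cohomology module of `R`. -/
def socLocalCohomology (i : ℕ) : WithBot ℕ∞ :=
  moduleLength R
    ↥(Submodule.torsionBySet R ↥((localCohomology (maximalIdeal R) i).obj (ModuleCat.of R R))
      (maximalIdeal R : Set R))

/-- A system of parameters `x₁, …, x_d` is standard if
`𝔮·H^i_𝔪(R/(x₁,…,x_j)R) = 0` for all `i + j < d`, where `𝔮 = (x₁,…,x_d)`. -/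
def IsStandardSOP (d : ℕ) (x : Fin d → R) : Prop :=
  (Ideal.span (Set.range x)).radical = maximalIdeal R ∧
  ∀ i j : ℕ, i + j < d →
    ∀ a ∈ Ideal.span (Set.range x),
      ∀ v : ((localCohomology (maximalIdeal R) i).obj
        (ModuleCat.of R (R ⧸ Ideal.span (x '' {k : Fin d | (k : ℕ) < j})))), a • v = 0

/-- `R` is a regular local ring of dimension `d`: `𝔪` is generated by `d` elements. -/
def IsRegularLocal (d : ℕ) : Prop :=
  ∃ x : Fin d → R, maximalIdeal R = Ideal.span (Set.range x)

/-- `R` is Gorenstein: `R` is Cohen–Macaulay of Cohen–Macaulay type `r(R) = 1`. -/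
def IsGorenstein (d : ℕ) : Prop :=
  IsCohenMacaulay R ∧ cmType R d = 1

section Colength

variable {A : Type*} [CommRing A]

lemma length_quotient_eq_add_of_sup_range {M N : Type*} [AddCommGroup M] [Module A M]
    [AddCommGroup N] [Module A N] (φ : M →ₗ[A] N) {I J : Submodule A N}
    (h : I ⊔ LinearMap.range φ = J) :
    Module.length A (N ⧸ I) =
      Module.length A (N ⧸ J) + Module.length A (M ⧸ Submodule.comap φ I) := by
  have hIJ : I ≤ J := h ▸ le_sup_left
  rw [add_comm]
  refine Module.length_eq_add_of_exact (Submodule.mapQ _ I φ le_rfl)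
    (Submodule.factor hIJ) ?_ (Submodule.factor_surjective hIJ) ?_
  · rw [← LinearMap.ker_eq_bot, Submodule.ker_mapQ, Submodule.mkQ_map_self]
  · rw [LinearMap.exact_iff, Submodule.range_mapQ, Submodule.factor, Submodule.ker_mapQ,
      Submodule.comap_id, ← h, Submodule.map_sup, Submodule.mkQ_map_self, bot_sup_eq]

lemma length_quotient_anti {N : Type*} [AddCommGroup N] [Module A N] {I J : Submodule A N}
    (h : I ≤ J) : Module.length A (N ⧸ J) ≤ Module.length A (N ⧸ I) :=
  Module.length_le_of_surjective (Submodule.factor h) (Submodule.factor_surjective h)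

lemma length_quotient_le_add {I K : Ideal A} (y : A) (h : ∀ b ∈ K, b * y ∈ I) :
    Module.length A (A ⧸ I) ≤
      Module.length A (A ⧸ (I ⊔ Ideal.span {y})) + Module.length A (A ⧸ K) := by
  rw [length_quotient_eq_add_of_sup_range (LinearMap.toSpanSingleton A A y) rfl,
    LinearMap.range_toSpanSingleton]
  refine add_le_add le_rfl (length_quotient_anti ?_)
  intro b hb
  simpa using h b hb

lemma length_quotient_sup_span_pow_le (I : Ideal A) (x : A) (t : ℕ) :
    Module.length A (A ⧸ (I ⊔ Ideal.span {x ^ t})) ≤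
      t * Module.length A (A ⧸ (I ⊔ Ideal.span {x})) := by
  induction t with
  | zero =>
    have : Subsingleton (A ⧸ (I ⊔ Ideal.span {x ^ 0})) := by
      rw [Ideal.Quotient.subsingleton_iff]; simp
    simp [Module.length_eq_zero]
  | succ t ih =>
    refine (length_quotient_le_add (K := I ⊔ Ideal.span {x}) (x ^ t) ?_).trans ?_
    · intro b hb
      obtain ⟨i, hi, c, hc, rfl⟩ := Submodule.mem_sup.mp hb
      obtain ⟨c, rfl⟩ := Ideal.mem_span_singleton'.mp hc
      rw [add_mul]
      refine Submodule.add_mem_sup (I.mul_mem_right _ hi) ?_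
      exact Ideal.mem_span_singleton'.mpr ⟨c, by ring⟩
    · push_cast
      rw [add_mul, one_mul]
      refine add_le_add ((length_quotient_anti ?_).trans ih) le_rfl
      exact sup_le_sup_right le_sup_left _

lemma length_quotient_sup_span_image_pow_le {ι : Type*} [DecidableEq ι] (I : Ideal A) (x : ι → A)
    (t : ℕ) (S : Finset ι) :
    Module.length A (A ⧸ (I ⊔ Ideal.span ((fun i => x i ^ t) '' S))) ≤
      (t ^ S.card : ℕ) * Module.length A (A ⧸ (I ⊔ Ideal.span (x '' S))) := by
  induction S using Finset.induction_on generalizing I with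
  | empty =>
    rw [Finset.coe_empty, Set.image_empty, Set.image_empty, Finset.card_empty, pow_zero,
      Nat.cast_one, one_mul]
  | insert a S ha ih =>
    have key (f : ι → A) : I ⊔ Ideal.span (f '' ↑(insert a S)) =
        (I ⊔ Ideal.span (f '' S)) ⊔ Ideal.span {f a} := by
      rw [Finset.coe_insert, Set.image_insert_eq, Ideal.span_insert, sup_assoc,
        sup_comm (Ideal.span {f a})]
    have swap (f : ι → A) (b : A) : (I ⊔ Ideal.span (f '' S)) ⊔ Ideal.span {b} =
        (I ⊔ Ideal.span {b}) ⊔ Ideal.span (f '' S) := sup_right_comm _ _ _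
    rw [key, key, Finset.card_insert_of_notMem ha, pow_succ, mul_comm (t ^ S.card) t]
    refine (length_quotient_sup_span_pow_le _ _ _).trans ?_
    rw [swap, swap, Nat.cast_mul, mul_assoc]
    exact mul_le_mul_right (ih _) _

end Colength

section Forms

open MvPolynomial

variable {A : Type*} [CommRing A] [IsLocalRing A] {d : ℕ}

/-- Reduction of the coefficients of forms of degree `n` modulo the maximal ideal. -/
def formResidue (A : Type*) [CommRing A] [IsLocalRing A] (d n : ℕ) :
    homogeneousSubmodule (Fin d) A n →ₗ[A] MvPolynomial (Fin d) (ResidueField A) :=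
  (mapAlgHom (Algebra.ofId A (ResidueField A))).toLinearMap ∘ₗ Submodule.subtype _

lemma formResidue_apply {n : ℕ} (F : homogeneousSubmodule (Fin d) A n) :
    formResidue A d n F = map (residue A) F.1 := rfl

lemma length_residueField : Module.length A (ResidueField A) = 1 := by
  rw [Module.length_eq_of_surjective (R := ResidueField A) residue_surjective,
    Module.length_eq_one]

lemma card_degree_eq (d n : ℕ) :
    ENat.card {s : Fin d →₀ ℕ // s.degree = n} = ((d + n - 1).choose n : ℕ) := by
  classical
  have e : {s : Fin d →₀ ℕ // s.degree = n} ≃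
      ((Finset.univ : Finset (Fin d)).finsuppAntidiag n : Finset (Fin d →₀ ℕ)) :=
    Equiv.subtypeEquivRight fun s => by simp [Finset.mem_finsuppAntidiag, Finsupp.degree_eq_sum]
  rw [ENat.card_congr e, ENat.card_eq_coe_fintype_card, Fintype.card_coe,
    Finset.card_finsuppAntidiag_nat_eq_choose, Finset.card_univ, Fintype.card_fin]

lemma length_range_formResidue (n : ℕ) :
    Module.length A (homogeneousSubmodule (Fin d) A n ⧸ LinearMap.ker (formResidue A d n)) =
      ((d + n - 1).choose n : ℕ) := by
  classical
  let s := {s : Fin d →₀ ℕ // s.degree = n}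
  let c : homogeneousSubmodule (Fin d) A n →ₗ[A] (s → ResidueField A) :=
    LinearMap.pi fun a => (Algebra.linearMap A (ResidueField A)) ∘ₗ (lcoeff A a.1) ∘ₗ
      Submodule.subtype _
  have hc (F : homogeneousSubmodule (Fin d) A n) (a : s) : c F a = residue A (coeff a.1 F.1) := rfl
  have hker : LinearMap.ker (formResidue A d n) = LinearMap.ker c := by
    ext F
    rw [LinearMap.mem_ker, LinearMap.mem_ker, formResidue_apply, funext_iff, MvPolynomial.ext_iff]
    simp only [coeff_map, coeff_zero, hc, Pi.zero_apply]
    refine ⟨fun h a => h a.1, fun h a => ?_⟩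
    by_cases ha : a.degree = n
    · exact h ⟨a, ha⟩
    · rw [IsHomogeneous.coeff_eq_zero F.2 ha, map_zero]
  have hfin : Finite s := by
    have := card_degree_eq d n
    by_contra hinf
    rw [not_finite_iff_infinite] at hinf
    rw [ENat.card_eq_top_of_infinite] at this
    exact ENat.top_ne_natCast _ this
  have hsurj : Function.Surjective c := by
    have := Fintype.ofFinite s
    intro v
    choose w hw using fun a => residue_surjective (R := A) (v a)
    refine ⟨⟨∑ a : s, monomial a.1 (w a), ?_⟩, ?_⟩
    · exact Submodule.sum_mem _ fun a _ => isHomogeneous_monomial _ a.2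
    · funext a
      rw [hc, coeff_sum, Finset.sum_eq_single a]
      · rw [coeff_monomial, if_pos rfl, hw]
      · intro b _ hb
        rw [coeff_monomial, if_neg fun h => hb (Subtype.ext h)]
      · simp
  rw [hker, (c.quotKerEquivOfSurjective hsurj).length_eq, Module.length_pi, length_residueField,
    mul_one, card_degree_eq]

end Forms

section Forms

open MvPolynomial

variable {A : Type*} [CommRing A] {d : ℕ}

/-- Evaluation of forms of degree `n` at `x`, multiplied by `y`. -/
def formEval (x : Fin d → A) (y : A) (n : ℕ) : homogeneousSubmodule (Fin d) A n →ₗ[A] A :=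
  (LinearMap.mulLeft A y) ∘ₗ (aeval x).toLinearMap ∘ₗ Submodule.subtype _

lemma formEval_apply (x : Fin d → A) (y : A) {n : ℕ} (F : homogeneousSubmodule (Fin d) A n) :
    formEval x y n F = y * eval x F.1 := by
  rw [← coe_aeval_eq_eval]; rfl

lemma range_formEval (x : Fin d → A) (y : A) (n : ℕ) :
    LinearMap.range (formEval x y n) = Ideal.span {y} * Ideal.span (Set.range x) ^ n := by
  ext a
  rw [LinearMap.mem_range, Ideal.mem_span_singleton_mul]
  simp only [Ideal.mem_span_pow_iff_exists_isHomogeneous, formEval_apply]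
  constructor
  · rintro ⟨F, rfl⟩
    exact ⟨_, ⟨F.1, F.2, rfl⟩, rfl⟩
  · rintro ⟨_, ⟨F, hF, rfl⟩, rfl⟩
    exact ⟨⟨F, hF⟩, rfl⟩

lemma length_quotient_mul_pow_eq (x : Fin d → A) (I : Ideal A) (y : A) (n : ℕ) :
    Module.length A (A ⧸ I * Ideal.span (Set.range x) ^ n) =
      Module.length A (A ⧸ (I ⊔ Ideal.span {y}) * Ideal.span (Set.range x) ^ n) +
      Module.length A (homogeneousSubmodule (Fin d) A n ⧸
        Submodule.comap (formEval x y n) (I * Ideal.span (Set.range x) ^ n)) := by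
  refine length_quotient_eq_add_of_sup_range _ ?_
  rw [range_formEval, Ideal.sup_mul]

end Forms

section Forms

open MvPolynomial

variable {A : Type*} [CommRing A] [IsLocalRing A] {d : ℕ}

lemma eval_mem_of_map_residue_eq_zero (x : Fin d → A) {n : ℕ} {F : MvPolynomial (Fin d) A}
    (hF : F.IsHomogeneous n) (h : map (residue A) F = 0) :
    eval x F ∈ maximalIdeal A * Ideal.span (Set.range x) ^ n := by
  rw [eval_eq]
  refine Submodule.sum_mem _ fun s hs => Ideal.mul_mem_mul ?_ ?_
  · rw [← residue_eq_zero_iff, ← coeff_map, h, coeff_zero]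
  · have : s.degree = n := by
      by_contra hne
      exact mem_support_iff.mp hs (hF.coeff_eq_zero hne)
    rw [← this, Finsupp.degree_apply, ← Finset.prod_pow_eq_pow_sum]
    exact Ideal.prod_mem_prod fun i _ =>
      Ideal.pow_mem_pow (Ideal.subset_span (α := A) (Set.mem_range_self i)) _

lemma ker_formResidue_le (x : Fin d → A) {I : Ideal A} {y : A}
    (hy : ∀ b ∈ maximalIdeal A, b * y ∈ I) (n : ℕ) :
    LinearMap.ker (formResidue A d n) ≤
      Submodule.comap (formEval x y n) (I * Ideal.span (Set.range x) ^ n) := by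
  intro F hF
  rw [Submodule.mem_comap, formEval_apply]
  have := Ideal.mul_mem_mul (Ideal.mem_span_singleton_self y)
    (eval_mem_of_map_residue_eq_zero x F.2 hF)
  rw [← mul_assoc] at this
  refine Ideal.mul_mono_left ?_ this
  rw [Ideal.span_singleton_mul_le_iff]
  intro b hb
  rw [mul_comm]
  exact hy b hb

end Forms

section FormRelations

open MvPolynomial

variable {A : Type*} [CommRing A] [IsLocalRing A] {d : ℕ}

lemma length_quotient_mul_pow_eq_choose_or_exists_form (x : Fin d → A) {I : Ideal A} {y : A}
    (hy : ∀ b ∈ maximalIdeal A, b * y ∈ I) :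
    (∀ n, Module.length A (A ⧸ I * Ideal.span (Set.range x) ^ n) =
      Module.length A (A ⧸ (I ⊔ Ideal.span {y}) * Ideal.span (Set.range x) ^ n) +
        ((d + n - 1).choose n : ℕ)) ∨
    ∃ (g : ℕ) (F : MvPolynomial (Fin d) A), F.IsHomogeneous g ∧ map (residue A) F ≠ 0 ∧
      y * eval x F ∈ I * Ideal.span (Set.range x) ^ g := by
  by_cases h : ∀ n, Submodule.comap (formEval x y n) (I * Ideal.span (Set.range x) ^ n) ≤
      LinearMap.ker (formResidue A d n)
  · left
    intro n
    rw [length_quotient_mul_pow_eq x I y n, le_antisymm (h n) (ker_formResidue_le x hy n),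
      length_range_formResidue]
  · right
    push Not at h
    obtain ⟨g, hg⟩ := h
    obtain ⟨F, hF, hF'⟩ := SetLike.not_le_iff_exists.mp hg
    refine ⟨g, F.1, F.2, ?_, ?_⟩
    · rwa [LinearMap.mem_ker, formResidue_apply] at hF'
    · rwa [Submodule.mem_comap, formEval_apply] at hF

/-- Multiplication by a form of degree `g` on forms of degree `m`. -/
def formMul {g : ℕ} {F : MvPolynomial (Fin d) A} (hF : F.IsHomogeneous g) (m : ℕ) :
    homogeneousSubmodule (Fin d) A m →ₗ[A] homogeneousSubmodule (Fin d) A (g + m) :=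
  ((LinearMap.mulLeft A F) ∘ₗ Submodule.subtype _).codRestrict _ fun G => hF.mul G.2

lemma length_formEval_add_choose_le (x : Fin d → A) {I : Ideal A} {y : A}
    (hy : ∀ b ∈ maximalIdeal A, b * y ∈ I) {g : ℕ} {F : MvPolynomial (Fin d) A}
    (hF : F.IsHomogeneous g) (hF0 : map (residue A) F ≠ 0)
    (hFI : y * eval x F ∈ I * Ideal.span (Set.range x) ^ g) (m : ℕ) :
    Module.length A (homogeneousSubmodule (Fin d) A (g + m) ⧸
        Submodule.comap (formEval x y (g + m)) (I * Ideal.span (Set.range x) ^ (g + m))) +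
      ((d + m - 1).choose m : ℕ) ≤ ((d + (g + m) - 1).choose (g + m) : ℕ) := by
  have hker : Submodule.comap (formMul hF m) (LinearMap.ker (formResidue A d (g + m))) =
      LinearMap.ker (formResidue A d m) := by
    ext G
    have : formResidue A d (g + m) (formMul hF m G) = map (residue A) F * map (residue A) G.1 :=
      map_mul (map (residue A)) _ _
    rw [Submodule.mem_comap, LinearMap.mem_ker, LinearMap.mem_ker, this, formResidue_apply,
      mul_eq_zero, or_iff_right hF0]
  rw [← length_range_formResidue (A := A) (g + m), ← length_range_formResidue (A := A) m,
    length_quotient_eq_add_of_sup_range (formMul hF m)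
      (I := LinearMap.ker (formResidue A d (g + m))) rfl, hker]
  refine add_le_add (length_quotient_anti ?_) le_rfl
  refine sup_le (ker_formResidue_le x hy _) ?_
  rintro _ ⟨G, rfl⟩
  rw [Submodule.mem_comap, formEval_apply]
  have : y * eval x (formMul hF m G).1 = (y * eval x F) * eval x G.1 := by
    rw [mul_assoc, ← map_mul]; rfl
  rw [this, pow_add, ← mul_assoc]
  exact Ideal.mul_mem_mul hFI ((Ideal.mem_span_pow_iff_exists_isHomogeneous x _).mpr
    ⟨G.1, G.2, rfl⟩)

end FormRelations

section AnalyticIndependence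

open MvPolynomial

lemma eval_mul_of_isHomogeneous {A σ : Type*} [CommRing A] {F : MvPolynomial σ A} {g : ℕ}
    (hF : F.IsHomogeneous g) (w : A) (u : σ → A) :
    eval (fun i => w * u i) F = w ^ g * eval u F := by
  rw [eval_eq, eval_eq, Finset.mul_sum]
  refine Finset.sum_congr rfl fun s hs => ?_
  have hs' : s.degree = g := by
    by_contra hne
    exact mem_support_iff.mp hs (hF.coeff_eq_zero hne)
  simp only [mul_pow, Finset.prod_mul_distrib, Finset.prod_pow_eq_pow_sum]
  rw [← Finsupp.degree_apply, hs']
  ring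

lemma eval_sub_eval_mem {A σ : Type*} [CommRing A] (I : Ideal A) (F : MvPolynomial σ A)
    {x y : σ → A} (h : ∀ i, x i - y i ∈ I) : eval x F - eval y F ∈ I := by
  have h' (i : σ) : Ideal.Quotient.mk I (x i) = Ideal.Quotient.mk I (y i) :=
    Ideal.Quotient.eq.mpr (h i)
  rw [← Ideal.Quotient.eq]
  simp only [eval_eq, map_sum, map_mul, map_prod, map_pow, h']

lemma pow_le_sup_span_pow {A : Type*} [CommRing A] {q I : Ideal A} {w : A}
    (h : q ≤ I ⊔ Ideal.span {w}) (n : ℕ) : q ^ n ≤ I ⊔ Ideal.span {w ^ n} := by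
  induction n with
  | zero => simp
  | succ n ih =>
    rw [pow_succ]
    refine (Ideal.mul_mono ih h).trans ?_
    rw [Ideal.sup_mul]
    refine sup_le (Ideal.mul_le_left.trans le_sup_left) ?_
    rw [Ideal.mul_sup, Ideal.span_singleton_mul_span_singleton, ← pow_succ]
    exact sup_le (Ideal.mul_le_right.trans le_sup_left) le_sup_right

variable {A : Type*} [CommRing A] [IsLocalRing A] [IsNoetherianRing A] {d : ℕ}

lemma not_maximalIdeal_le_radical_span (hdim : ringKrullDim A = d) (S : Set A) (hS : S.Finite)
    (hcard : S.ncard < d) (hSm : Ideal.span S ≤ maximalIdeal A) :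
    ¬ maximalIdeal A ≤ (Ideal.span S).radical := by
  intro h
  have hmin : maximalIdeal A ∈ (Ideal.span S).minimalPrimes := by
    refine ⟨⟨inferInstance, hSm⟩, fun p hp _ => h.trans ?_⟩
    exact (Ideal.IsPrime.radical_le_iff hp.1).mpr hp.2
  have h1 := Ideal.height_le_spanRank_toENat_of_mem_minimalPrimes _ _ hmin
  have h2 : (Ideal.span S).spanRank.toENat ≤ (S.ncard : ℕ∞) := by
    have h3 := OrderHomClass.mono Cardinal.toENat (Submodule.spanRank_span_le_card (R := A) S)
    exact h3.trans (hS.cast_ncard_eq ▸ le_rfl)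
  have h4 : ((maximalIdeal A).height : WithBot ℕ∞) = d := by
    rw [maximalIdeal_height_eq_ringKrullDim, hdim]
  have h5 : (maximalIdeal A).height = (d : ℕ∞) := by exact_mod_cast h4
  rw [h5] at h1
  exact absurd (Nat.cast_le.mp (h1.trans h2)) (not_le.mpr hcard)

/-- A system of parameters is analytically independent. -/
lemma map_residue_eq_zero_of_eval_mem [Infinite (ResidueField A)] (hdim : ringKrullDim A = d)
    {x : Fin d → A} (hx : (Ideal.span (Set.range x)).radical = maximalIdeal A) {g : ℕ}
    {F : MvPolynomial (Fin d) A} (hF : F.IsHomogeneous g)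
    (h : eval x F ∈ maximalIdeal A * Ideal.span (Set.range x) ^ g) :
    map (residue A) F = 0 := by
  set q := Ideal.span (Set.range x) with hq
  have hqm : q ≤ maximalIdeal A := hx ▸ Ideal.le_radical
  have hxm (i : Fin d) : x i ∈ maximalIdeal A :=
    hqm (Ideal.subset_span (Set.mem_range_self i))
  refine (hF.map (residue A)).eq_zero_of_forall_eval_eq_zero fun u' => ?_
  choose u hu using fun i => residue_surjective (R := A) (u' i)
  obtain rfl : (fun i => residue A (u i)) = u' := funext hu
  have hres : eval (fun i => residue A (u i)) (map (residue A) F) = residue A (eval u F) := by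
    rw [MvPolynomial.eval_map, eval₂_eq, eval_eq]
    simp only [map_sum, map_mul, map_prod, map_pow]
  rw [hres, residue_eq_zero_iff]
  by_contra hunit
  by_cases hall : ∀ i, u i ∈ maximalIdeal A
  · refine hunit ?_
    have h0 : eval u F - eval x F ∈ maximalIdeal A :=
      eval_sub_eval_mem _ _ fun i => Ideal.sub_mem _ (hall i) (hxm i)
    exact (Submodule.sub_mem_iff_left _ (Ideal.mul_le_left h)).mp h0
  · push Not at hall
    obtain ⟨j, hj⟩ := hall
    have hjunit : IsUnit (u j) := by simpa using hj
    have hFunit : IsUnit (eval u F) := by simpa using hunit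
    obtain ⟨v, hv⟩ := hjunit.exists_left_inv
    set w := x j * v with hw
    set S : Set A := (fun i => x i - w * u i) '' {j}ᶜ with hS
    have hdiff (i : Fin d) : x i - w * u i ∈ Ideal.span S := by
      by_cases hij : i = j
      · subst hij
        rw [hw, mul_assoc, hv, mul_one, sub_self]; exact Ideal.zero_mem _
      · exact Ideal.subset_span ⟨i, hij, rfl⟩
    have hwq : w ∈ q := Ideal.mul_mem_right _ _ (Ideal.subset_span (Set.mem_range_self j))
    have hSq : Ideal.span S ≤ q := by
      rw [Ideal.span_le]
      rintro _ ⟨i, -, rfl⟩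
      exact Ideal.sub_mem _ (Ideal.subset_span (Set.mem_range_self i)) (Ideal.mul_mem_right _ _ hwq)
    have hqw : q ≤ Ideal.span S ⊔ Ideal.span {w} := by
      rw [hq, Ideal.span_le]
      rintro _ ⟨i, rfl⟩
      have := Submodule.add_mem_sup (hdiff i) (Ideal.mem_span_singleton'.mpr ⟨u i, mul_comm _ w⟩)
      simpa using this
    have hwg : w ^ g ∈ Ideal.span S ⊔ maximalIdeal A * q ^ g := by
      have h1 := eval_sub_eval_mem (Ideal.span S) F hdiff
      rw [eval_mul_of_isHomogeneous hF] at h1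
      have h2 := Ideal.sub_mem _ ((le_sup_right : _ ≤ Ideal.span S ⊔ _) h)
        ((le_sup_left : _ ≤ _ ⊔ maximalIdeal A * q ^ g) h1)
      rw [sub_sub_cancel] at h2
      exact (Ideal.mul_unit_mem_iff_mem _ hFunit).mp h2
    have hle : q ^ g ≤ Ideal.span S := by
      refine Submodule.le_of_le_smul_of_le_jacobson_bot (I := maximalIdeal A)
        (IsNoetherian.noetherian _) (maximalIdeal_le_jacobson _) ?_
      refine (pow_le_sup_span_pow hqw g).trans (sup_le le_sup_left ?_)
      rw [Ideal.span_singleton_le_iff_mem]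
      exact hwg
    have hcard : S.ncard < d := by
      refine (Set.ncard_image_le (Set.toFinite _)).trans_lt ?_
      rw [Set.ncard_compl, Set.ncard_singleton, Nat.card_fin]
      exact Nat.sub_lt (Fin.pos j) one_pos
    refine not_maximalIdeal_le_radical_span hdim S (Set.toFinite _) hcard (hSq.trans hqm) ?_
    rw [← hx]
    exact Ideal.radical_le_radical_iff.mpr fun a ha => ⟨g, hle (Ideal.pow_mem_pow ha g)⟩

end AnalyticIndependence

section HilbertBounds

lemma choose_add_le_add_mul (c m g : ℕ) :
    (g + m + (c + 1)).choose (c + 1) ≤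
      (m + (c + 1)).choose (c + 1) + g * (g + m + c).choose c := by
  induction g with
  | zero => simp
  | succ g ih =>
    have h1 : (g + 1 + m + (c + 1)).choose (c + 1) =
        (g + 1 + m + c).choose c + (g + m + (c + 1)).choose (c + 1) := by
      rw [show g + 1 + m + (c + 1) = (g + 1 + m + c) + 1 by ring, Nat.choose_succ_succ,
        show g + 1 + m + c = g + m + (c + 1) by ring]
    have h2 : (g + m + c).choose c ≤ (g + 1 + m + c).choose c :=
      Nat.choose_le_choose _ (by omega)
    nlinarith

lemma choose_add_succ_le (c n : ℕ) :
    (n + (c + 1)).choose (c + 1) ≤ (n + 1) * (n + c).choose c := by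
  have h := choose_add_le_add_mul c 0 n
  have : 0 < (n + c).choose c := Nat.choose_pos (by omega)
  simp only [add_zero, zero_add, Nat.choose_self] at h
  nlinarith

lemma choose_symm_add_sub (c n : ℕ) : (c + 2 + n - 1).choose n = (n + (c + 1)).choose (c + 1) := by
  rw [show c + 2 + n - 1 = n + (c + 1) by omega, Nat.choose_symm_add]

open MvPolynomial

variable {A : Type*} [CommRing A] [IsLocalRing A] {c : ℕ}

lemma exists_notMem_forall_mul_mem {I : Ideal A} (hI : I ≠ ⊤)
    (hs : ∃ s, maximalIdeal A ^ s ≤ I) : ∃ y ∉ I, ∀ b ∈ maximalIdeal A, b * y ∈ I := by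
  classical
  obtain ⟨k, hk⟩ : ∃ k, Nat.find hs = k + 1 := Nat.exists_eq_succ_of_ne_zero fun h0 => by
    have := Nat.find_spec hs
    rw [h0, pow_zero, Ideal.one_eq_top, top_le_iff] at this
    exact hI this
  obtain ⟨y, hy, hyI⟩ := SetLike.not_le_iff_exists.mp (Nat.find_min hs (m := k) (by omega))
  refine ⟨y, hyI, fun b hb => Nat.find_spec hs ?_⟩
  rw [hk, pow_succ']
  exact Ideal.mul_mem_mul hb hy

lemma length_formEval_le_mul_choose (x : Fin (c + 2) → A) {I : Ideal A} {y : A}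
    (hy : ∀ b ∈ maximalIdeal A, b * y ∈ I) {g : ℕ} {F : MvPolynomial (Fin (c + 2)) A}
    (hF : F.IsHomogeneous g) (hF0 : map (residue A) F ≠ 0)
    (hFI : y * eval x F ∈ I * Ideal.span (Set.range x) ^ g) (n : ℕ) :
    Module.length A (homogeneousSubmodule (Fin (c + 2)) A n ⧸
        Submodule.comap (formEval x y n) (I * Ideal.span (Set.range x) ^ n)) ≤
      (g * (n + c).choose c : ℕ) := by
  rcases le_or_gt g n with h | h
  · obtain ⟨m, rfl⟩ := Nat.exists_eq_add_of_le h
    have h1 := length_formEval_add_choose_le x hy hF hF0 hFI m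
    rw [choose_symm_add_sub, choose_symm_add_sub] at h1
    have h2 := h1.trans (Nat.cast_le.mpr (choose_add_le_add_mul c m g))
    rw [Nat.cast_add, add_comm] at h2
    exact (ENat.add_le_add_iff_left (ENat.natCast_ne_top _)).mp h2
  · refine (length_quotient_anti (ker_formResidue_le x hy n)).trans ?_
    rw [length_range_formResidue, choose_symm_add_sub]
    exact Nat.cast_le.mpr ((choose_add_succ_le c n).trans (Nat.mul_le_mul_right _ h))

lemma exists_length_mul_pow_bounds [IsNoetherianRing A] (x : Fin (c + 2) → A) (I : Ideal A)
    (hI : ∃ s, maximalIdeal A ^ s ≤ I) :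
    ∃ e K : ℕ, ∀ n,
      Module.length A (A ⧸ Ideal.span (Set.range x) ^ n) +
          (e * (n + (c + 1)).choose (c + 1) : ℕ) ≤
        Module.length A (A ⧸ I * Ideal.span (Set.range x) ^ n) ∧
      Module.length A (A ⧸ I * Ideal.span (Set.range x) ^ n) ≤
        Module.length A (A ⧸ Ideal.span (Set.range x) ^ n) +
          (e * (n + (c + 1)).choose (c + 1) + K * (n + c).choose c : ℕ) := by
  induction I using IsNoetherian.induction with
  | hgt I ih =>
  by_cases htop : I = ⊤
  · exact ⟨0, 0, fun n => by rw [htop, Ideal.top_mul]; simp⟩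
  obtain ⟨y, hyI, hy⟩ := exists_notMem_forall_mul_mem htop hI
  have hlt : I < I ⊔ Ideal.span {y} := by
    refine lt_of_le_of_ne le_sup_left fun h => hyI ?_
    rw [h]
    exact Ideal.mem_sup_right (Ideal.mem_span_singleton_self y)
  obtain ⟨e, K, hJ⟩ := ih _ hlt (hI.imp fun s hs => hs.trans hlt.le)
  rcases length_quotient_mul_pow_eq_choose_or_exists_form x hy with h | ⟨g, F, hF, hF0, hFI⟩
  · refine ⟨e + 1, K, fun n => ?_⟩
    rw [h n, choose_symm_add_sub]
    constructor
    · rw [add_mul, one_mul, Nat.cast_add, ← add_assoc]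
      exact add_le_add (hJ n).1 le_rfl
    · refine (add_le_add (hJ n).2 le_rfl).trans (le_of_eq ?_)
      rw [add_assoc, ← Nat.cast_add]
      congr 2
      ring
  · refine ⟨e, K + g, fun n => ?_⟩
    rw [length_quotient_mul_pow_eq x I y n]
    constructor
    · exact (hJ n).1.trans le_self_add
    · rw [add_mul, ← add_assoc, Nat.cast_add, ← add_assoc]
      exact add_le_add (hJ n).2 (length_formEval_le_mul_choose x hy hF hF0 hFI n)

/-- The Hilbert–Samuel function of `q = (x₁, …, x_{c+2})` up to an error of order `n ^ (c + 1)`. -/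
lemma exists_length_pow_bounds [IsNoetherianRing A] (x : Fin (c + 2) → A)
    (hx : ∃ s, maximalIdeal A ^ s ≤ Ideal.span (Set.range x)) :
    ∃ e K : ℕ, ∀ n,
      ((e * (n + (c + 2)).choose (c + 2) : ℕ) : ℕ∞) ≤
        Module.length A (A ⧸ Ideal.span (Set.range x) ^ (n + 1)) ∧
      Module.length A (A ⧸ Ideal.span (Set.range x) ^ (n + 1)) ≤
        (e * (n + (c + 2)).choose (c + 2) + K * (n + (c + 1)).choose (c + 1) : ℕ) := by
  obtain ⟨e, K, h⟩ := exists_length_mul_pow_bounds x _ hx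
  refine ⟨e, K, fun n => ?_⟩
  replace h (n : ℕ) := pow_succ' (Ideal.span (Set.range x)) n ▸ h n
  have h0 : Module.length A (A ⧸ Ideal.span (Set.range x) ^ 0) = 0 := by
    have : Subsingleton (A ⧸ Ideal.span (Set.range x) ^ 0) := by
      rw [Ideal.Quotient.subsingleton_iff, pow_zero, Ideal.one_eq_top]
    exact Module.length_eq_zero
  induction n with
  | zero => simpa [h0] using h 0
  | succ n ih =>
    have hd : (n + 1 + (c + 2)).choose (c + 2) =
        (n + 1 + (c + 1)).choose (c + 1) + (n + (c + 2)).choose (c + 2) := by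
      rw [show n + 1 + (c + 2) = (n + 1 + (c + 1)) + 1 by ring, Nat.choose_succ_succ,
        show n + 1 + (c + 1) = n + (c + 2) by ring]
    have hc : (n + 1 + (c + 1)).choose (c + 1) =
        (n + 1 + c).choose c + (n + (c + 1)).choose (c + 1) := by
      rw [show n + 1 + (c + 1) = (n + 1 + c) + 1 by ring, Nat.choose_succ_succ,
        show n + 1 + c = n + (c + 1) by ring]
    constructor
    · refine le_trans (le_of_eq ?_) ((add_le_add ih.1 le_rfl).trans (h (n + 1)).1)
      rw [← Nat.cast_add, hd]
      congr 1
      ring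
    · refine ((h (n + 1)).2.trans (add_le_add ih.2 le_rfl)).trans (le_of_eq ?_)
      rw [← Nat.cast_add, hd]
      congr 1
      conv_rhs => rw [hc]
      rw [hc]
      ring

lemma choose_le_length_pow [IsNoetherianRing A] [Infinite (ResidueField A)]
    (hdim : ringKrullDim A = (c + 2 : ℕ)) {x : Fin (c + 2) → A}
    (hx : (Ideal.span (Set.range x)).radical = maximalIdeal A) (n : ℕ) :
    ((n + (c + 2)).choose (c + 2) : ℕ∞) ≤
      Module.length A (A ⧸ Ideal.span (Set.range x) ^ (n + 1)) := by
  have hfree (n : ℕ) : Module.length A (A ⧸ Ideal.span (Set.range x) ^ n) +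
      ((n + (c + 1)).choose (c + 1) : ℕ) ≤
        Module.length A (A ⧸ Ideal.span (Set.range x) ^ (n + 1)) := by
    have hqm : Ideal.span (Set.range x) ≤ maximalIdeal A := hx ▸ Ideal.le_radical
    rcases length_quotient_mul_pow_eq_choose_or_exists_form x (I := maximalIdeal A) (y := 1)
      (fun b hb => by rwa [mul_one]) with h | ⟨g, F, hF, hF0, hFI⟩
    · have h1 := h n
      rw [Ideal.span_singleton_one, sup_top_eq, Ideal.top_mul, choose_symm_add_sub] at h1
      rw [← h1, pow_succ']
      exact length_quotient_anti (Ideal.mul_mono_left hqm)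
    · rw [one_mul] at hFI
      exact absurd (map_residue_eq_zero_of_eval_mem hdim hx hF hFI) hF0
  induction n with
  | zero => exact le_trans (by simp) (le_add_self.trans (hfree 0))
  | succ n ih =>
    refine le_trans (le_of_eq ?_) ((add_le_add ih le_rfl).trans (hfree (n + 1)))
    rw [show n + 1 + (c + 2) = (n + 1 + (c + 1)) + 1 by ring, Nat.choose_succ_succ,
      show n + 1 + (c + 1) = n + (c + 2) by ring, add_comm, Nat.cast_add]

end HilbertBounds

section SocleOfPowers

open MvPolynomial

lemma span_range_pow_mul_le {A : Type*} [CommRing A] {d : ℕ} (hd : 0 < d) (z : Fin d → A) (N : ℕ) :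
    Ideal.span (Set.range z) ^ (d * N) ≤ Ideal.span (Set.range fun i => z i ^ N) := by
  intro a ha
  obtain ⟨F, hF, rfl⟩ := (Ideal.mem_span_pow_iff_exists_isHomogeneous z _).mp ha
  rw [MvPolynomial.eval_eq']
  refine Ideal.sum_mem _ fun s hs => Ideal.mul_mem_left _ _ ?_
  have hs' : s.degree = d * N := by
    by_contra hne
    exact mem_support_iff.mp hs (hF.coeff_eq_zero hne)
  obtain ⟨i, -, hi⟩ : ∃ i ∈ Finset.univ, N ≤ s i := by
    refine Finset.exists_le_of_sum_le (s := Finset.univ) ⟨⟨0, hd⟩, Finset.mem_univ _⟩ ?_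
    rw [← Finsupp.degree_eq_sum, hs']
    simp
  rw [← Finset.mul_prod_erase _ _ (Finset.mem_univ i)]
  have hi' : z i ^ N ∈ Ideal.span (Set.range fun i => z i ^ N) := Ideal.subset_span ⟨i, rfl⟩
  exact Ideal.mul_mem_right _ _ (Ideal.mem_of_dvd _ (pow_dvd_pow _ hi) hi')

lemma span_image_erase_sup_span {A : Type*} [CommRing A] {d : ℕ} {x b : Fin d → A} {i : Fin d} (hi : IsUnit (b i)) :
    Ideal.span (x '' (Finset.univ.erase i : Finset (Fin d))) ⊔ Ideal.span {∑ j, b j * x j} =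
      Ideal.span (Set.range x) := by
  have hmem (j : Fin d) : x j ∈ Ideal.span (Set.range x) :=
    Ideal.subset_span (Set.mem_range_self j)
  refine le_antisymm (sup_le (Ideal.span_mono (Set.image_subset_range _ _)) ?_) ?_
  · rw [Ideal.span_singleton_le_iff_mem]
    exact Ideal.sum_mem _ fun j _ => Ideal.mul_mem_left _ _ (hmem j)
  · have hne (j : Fin d) (hj : j ≠ i) :
        x j ∈ Ideal.span (x '' (Finset.univ.erase i : Finset (Fin d))) :=
      Ideal.subset_span ⟨j, by simpa using hj, rfl⟩
    rw [Ideal.span_le]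
    rintro _ ⟨j, rfl⟩
    by_cases hj : j = i
    · subst hj
      refine (Ideal.unit_mul_mem_iff_mem _ hi).mp ?_
      have hsum := Finset.add_sum_erase Finset.univ (fun k => b k * x k) (Finset.mem_univ j)
      rw [eq_sub_of_add_eq hsum]
      refine Ideal.sub_mem _ (Ideal.mem_sup_right (Ideal.mem_span_singleton_self _))
        (Ideal.mem_sup_left (Ideal.sum_mem _ fun k hk => Ideal.mul_mem_left _ _ (hne k ?_)))
      exact Finset.ne_of_mem_erase hk
    · exact Ideal.mem_sup_left (hne j hj)

variable {A : Type*} [CommRing A] [IsLocalRing A] {c : ℕ}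

lemma length_quotient_sup_span_pow_mul_le {𝔟 : Ideal A} {a y : A} {r : ℕ}
    (har : a ^ r ∈ 𝔟 ⊔ Ideal.span {a * y})
    (hy : ∀ b ∈ maximalIdeal A, b * y ∈ 𝔟 ⊔ Ideal.span {a * y}) (t : ℕ) :
    Module.length A (A ⧸ 𝔟 ⊔ Ideal.span {(a * y) ^ t}) ≤
      Module.length A (A ⧸ 𝔟 ⊔ Ideal.span {a * y}) + (t * r : ℕ) := by
  set 𝔭 : Ideal A := Submodule.comap (LinearMap.toSpanSingleton A A y) 𝔟 with h𝔭
  have mem𝔭 (b : A) : b ∈ 𝔭 ↔ b * y ∈ 𝔟 := by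
    rw [h𝔭, Submodule.mem_comap, LinearMap.toSpanSingleton_apply, smul_eq_mul]
  have hb𝔭 : 𝔟 ≤ 𝔭 := fun b hb => (mem𝔭 b).mpr (Ideal.mul_mem_right _ _ hb)
  have h1 : Module.length A (A ⧸ 𝔭 ⊔ Ideal.span {a}) ≤ 1 := by
    rw [← length_residueField (A := A)]
    refine length_quotient_anti fun b hb => ?_
    obtain ⟨β, hβ, w, hw, hsum⟩ := Submodule.mem_sup.mp (hy b hb)
    obtain ⟨v, rfl⟩ := Ideal.mem_span_singleton'.mp hw
    have : b - v * a ∈ 𝔭 := by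
      rw [mem𝔭]
      convert hβ using 1
      linear_combination -hsum
    rw [← sub_add_cancel b (v * a)]
    exact Submodule.add_mem_sup this (Ideal.mem_span_singleton'.mpr ⟨v, rfl⟩)
  have h2 : Module.length A (A ⧸ 𝔭 ⊔ Ideal.span {a * y}) ≤ r := by
    have hle : 𝔭 ⊔ Ideal.span {a ^ r} ≤ 𝔭 ⊔ Ideal.span {a * y} := by
      refine sup_le le_sup_left ?_
      rw [Ideal.span_singleton_le_iff_mem]
      exact sup_le_sup_right hb𝔭 _ har
    refine (length_quotient_anti hle).trans ((length_quotient_sup_span_pow_le 𝔭 a r).trans ?_)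
    simpa using mul_le_mul_right h1 (r : ℕ∞)
  have h3 : Module.length A (A ⧸ 𝔭 ⊔ Ideal.span {(a * y) ^ t}) ≤ (t * r : ℕ) := by
    refine (length_quotient_sup_span_pow_le 𝔭 (a * y) t).trans ?_
    rw [Nat.cast_mul]
    exact mul_le_mul_right h2 (t : ℕ∞)
  refine (length_quotient_le_add (K := 𝔭 ⊔ Ideal.span {(a * y) ^ t}) y ?_).trans
    (add_le_add (length_quotient_anti ?_) h3)
  · intro b hb
    obtain ⟨β, hβ, w, hw, rfl⟩ := Submodule.mem_sup.mp hb
    rw [add_mul]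
    exact Submodule.add_mem_sup ((mem𝔭 β).mp hβ) (Ideal.mul_mem_right _ _ hw)
  · refine sup_le (le_sup_left.trans le_sup_left) ?_
    rw [Ideal.span_singleton_le_iff_mem]
    exact Ideal.mem_sup_right (Ideal.mem_span_singleton'.mpr ⟨a, rfl⟩)

lemma length_pow_le_of_mul_notMem {x : Fin (c + 2) → A} {r : ℕ}
    (hr : maximalIdeal A ^ r ≤ Ideal.span (Set.range x)) {a y : A} (ha : a ∈ maximalIdeal A)
    (hy : ∀ b ∈ maximalIdeal A, b * y ∈ Ideal.span (Set.range x))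
    (hay : a * y ∉ maximalIdeal A * Ideal.span (Set.range x)) (t : ℕ) :
    Module.length A (A ⧸ Ideal.span (Set.range x) ^ t) ≤
      (t ^ (c + 1) : ℕ) * (Module.length A (A ⧸ Ideal.span (Set.range x)) + (t * r : ℕ)) := by
  obtain ⟨b, hb⟩ := (Ideal.mem_span_range_iff_exists_fun).mp (hy a ha)
  obtain ⟨i, hi⟩ : ∃ i, IsUnit (b i) := by
    by_contra! h
    refine hay (hb ▸ Ideal.sum_mem _ fun j _ => Ideal.mul_mem_mul ?_ ?_)
    · exact (mem_maximalIdeal _).mpr (h j)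
    · exact Ideal.subset_span (Set.mem_range_self j)
  have hq := span_image_erase_sup_span (x := x) hi
  rw [hb] at hq
  set S : Finset (Fin (c + 2)) := Finset.univ.erase i with hS
  have hcard : S.card = c + 1 := by
    rw [hS, Finset.card_erase_of_mem (Finset.mem_univ i), Finset.card_fin]; rfl
  have h1 := length_quotient_sup_span_pow_mul_le (hq ▸ hr (Ideal.pow_mem_pow ha r))
    (fun b hb => hq ▸ hy b hb) t
  rw [hq, sup_comm] at h1
  have h2 := length_quotient_sup_span_image_pow_le (Ideal.span {(a * y) ^ t}) x t S
  rw [hcard] at h2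
  refine (length_quotient_anti ?_).trans (h2.trans (mul_le_mul_right h1 _))
  refine sup_le ?_ ?_
  · rw [Ideal.span_singleton_le_iff_mem]
    exact Ideal.pow_mem_pow (hy a ha) t
  · rw [Ideal.span_le]
    rintro _ ⟨j, -, rfl⟩
    exact Ideal.pow_mem_pow (Ideal.subset_span (Set.mem_range_self j)) t

/-- For large `N`, the socle of `A ⧸ (z₁ ^ N, …, z_d ^ N)` lifts to an ideal `I` with
`𝔪 * I ≤ 𝔪 * (z₁ ^ N, …, z_d ^ N)`. -/
lemma mul_mem_maximalIdeal_mul_span_pow [IsNoetherianRing A] [Infinite (ResidueField A)]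
    (hdim : ringKrullDim A = (c + 2 : ℕ)) {z : Fin (c + 2) → A}
    (hz : (Ideal.span (Set.range z)).radical = maximalIdeal A) {s N : ℕ}
    (hs : maximalIdeal A ^ s ≤ Ideal.span (Set.range z))
    (hN : (c + 2).factorial * (s * ((c + 2) * N)) < N ^ (c + 2)) {a y : A}
    (ha : a ∈ maximalIdeal A)
    (hy : ∀ b ∈ maximalIdeal A, b * y ∈ Ideal.span (Set.range fun i => z i ^ N)) :
    a * y ∈ maximalIdeal A * Ideal.span (Set.range fun i => z i ^ N) := by
  by_contra hay
  have hr : maximalIdeal A ^ (s * ((c + 2) * N)) ≤ Ideal.span (Set.range fun i => z i ^ N) := by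
    rw [pow_mul]
    exact (Ideal.pow_right_mono hs _).trans (span_range_pow_mul_le (by omega) z N)
  obtain ⟨e, K, h⟩ := exists_length_pow_bounds (fun i => z i ^ N) ⟨_, hr⟩
  have hC := (h 0).2
  rw [zero_add, pow_one] at hC
  generalize (e * (0 + (c + 2)).choose (c + 2) + K * (0 + (c + 1)).choose (c + 1) : ℕ) = C at hC
  have hle : Ideal.span (Set.range fun i => z i ^ N) ≤ Ideal.span (Set.range z) ^ N := by
    rw [Ideal.span_le]
    rintro _ ⟨i, rfl⟩
    exact Ideal.pow_mem_pow (Ideal.subset_span (Set.mem_range_self i)) N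
  have hN0 : 0 < N := Nat.pos_of_ne_zero fun h0 => by simp [h0] at hN
  have key (t : ℕ) (ht : 0 < t) :
      (N * t) ^ (c + 2) ≤ (c + 2).factorial * (t ^ (c + 1) * (C + t * (s * ((c + 2) * N)))) := by
    obtain ⟨n, hn⟩ : ∃ n, N * t = n + 1 :=
      Nat.exists_eq_succ_of_ne_zero (Nat.mul_pos hN0 ht).ne'
    have h1 := choose_le_length_pow hdim hz n
    rw [← hn, pow_mul] at h1
    have h2 := (h1.trans (length_quotient_anti (Ideal.pow_right_mono hle t))).trans
      ((length_pow_le_of_mul_notMem hr ha hy hay t).trans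
        (mul_le_mul_right (add_le_add hC le_rfl) _))
    rw [← Nat.cast_add, ← Nat.cast_mul, Nat.cast_le] at h2
    rw [hn]
    refine (Nat.pow_succ_le_ascFactorial _ _).trans ?_
    rw [Nat.ascFactorial_eq_factorial_mul_choose]
    exact Nat.mul_le_mul_left _ h2
  have h3 := key ((c + 2).factorial * C + 1) (Nat.succ_pos _)
  clear key
  generalize (c + 2).factorial = k at h3 hN
  generalize s * ((c + 2) * N) = M at h3 hN
  obtain ⟨T, hT⟩ : ∃ T, T = k * C + 1 := ⟨_, rfl⟩
  rw [← hT] at h3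
  have hTpos : 0 < T ^ (c + 1) := pow_pos (hT ▸ Nat.succ_pos _) _
  have h4 : N ^ (c + 2) * T ≤ k * C + T * (k * M) := by
    refine le_of_mul_le_mul_left (a := T ^ (c + 1)) ?_ hTpos
    calc _ = (N * T) ^ (c + 2) := by ring
      _ ≤ _ := h3
      _ = _ := by ring
  nlinarith

end SocleOfPowers

section Asymptotics

open Filter Topology

lemma tendsto_choose_add_div_pow (s k : ℕ) :
    Tendsto (fun n : ℕ => ((n + s + k).choose k : ℝ) / (n : ℝ) ^ k) atTop
      (𝓝 (1 / (k.factorial : ℝ))) := by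
  induction k with
  | zero => simp
  | succ k ih =>
    have h1 : Tendsto (fun n : ℕ => 1 + ((s + k + 1 : ℕ) : ℝ) / (n : ℝ)) atTop (𝓝 (1 + 0)) :=
      tendsto_const_nhds.add (tendsto_const_div_atTop_nhds_zero_nat _)
    have h2 := (ih.mul h1).div_const ((k + 1 : ℕ) : ℝ)
    have hlim : 1 / (k.factorial : ℝ) * (1 + 0) / ((k + 1 : ℕ) : ℝ) =
        1 / ((k + 1).factorial : ℝ) := by
      rw [Nat.factorial_succ, Nat.cast_mul, add_zero, mul_one, div_div, mul_comm]
    rw [hlim] at h2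
    refine h2.congr' ?_
    filter_upwards [eventually_gt_atTop 0] with n hn
    have hn' : (n : ℝ) ≠ 0 := by exact_mod_cast hn.ne'
    have hk : ((k + 1 : ℕ) : ℝ) ≠ 0 := by exact_mod_cast Nat.succ_ne_zero k
    have h3 : ((n + s + k + 1 : ℕ) : ℝ) * ((n + s + k).choose k : ℝ) =
        ((n + s + (k + 1)).choose (k + 1) : ℝ) * ((k + 1 : ℕ) : ℝ) := by
      exact_mod_cast Nat.add_one_mul_choose_eq (n + s + k) k
    field_simp
    push_cast at h3 ⊢
    linear_combination (n : ℝ) ^ (k + 1) * h3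

lemma tendsto_sum_choose_div_pow (s m : ℕ) (a : ℕ → ℤ) :
    Tendsto (fun n : ℕ => ((∑ i ∈ Finset.range (m + 1),
        a i * ((n + s + m - i).choose (m - i) : ℤ) : ℤ) : ℝ) / (n : ℝ) ^ m) atTop
      (𝓝 (a 0 / (m.factorial : ℝ))) := by
  have hterm (i : ℕ) (hi : i ∈ Finset.range (m + 1)) : Tendsto (fun n : ℕ =>
      (a i : ℝ) * ((n + s + m - i).choose (m - i) : ℝ) / (n : ℝ) ^ m) atTop
      (𝓝 (if i = 0 then a 0 / (m.factorial : ℝ) else 0)) := by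
    have him : i ≤ m := Nat.lt_succ_iff.mp (Finset.mem_range.mp hi)
    have h1 := ((tendsto_choose_add_div_pow s (m - i)).const_mul (a i : ℝ))
    split_ifs with h0
    · subst h0
      simpa [mul_assoc, div_eq_mul_inv] using h1
    · have h2 := h1.mul ((tendsto_pow_atTop (α := ℝ) h0).comp
        tendsto_natCast_atTop_atTop).inv_tendsto_atTop
      rw [mul_zero] at h2
      refine h2.congr' ?_
      filter_upwards [eventually_gt_atTop 0] with n hn
      have hn' : (n : ℝ) ≠ 0 := by exact_mod_cast hn.ne'
      have hpow : (n : ℝ) ^ m = (n : ℝ) ^ (m - i) * (n : ℝ) ^ i := by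
        rw [← pow_add, Nat.sub_add_cancel him]
      rw [Nat.add_sub_assoc him, hpow]
      simp only [Pi.inv_apply, Function.comp_apply]
      field_simp
  have h := tendsto_finsetSum (Finset.range (m + 1)) hterm
  rw [Finset.sum_ite_eq' (Finset.range (m + 1)) 0, if_pos (by simp)] at h
  refine h.congr fun n => ?_
  push_cast
  rw [Finset.sum_div]

lemma coeff_one_le_of_eventually_le {c : ℕ} {e f : ℕ → ℤ} {E K : ℤ} {h : ℕ → ℤ}
    (hlow : ∀ᶠ n in atTop, E * ((n + (c + 2)).choose (c + 2) : ℤ) ≤ h n)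
    (hupp : ∀ᶠ n in atTop, h n ≤ E * ((n + (c + 2)).choose (c + 2) : ℤ) +
      K * ((n + (c + 1)).choose (c + 1) : ℤ))
    (he : ∀ᶠ n in atTop, ∑ i ∈ Finset.range (c + 2 + 1),
      (-1 : ℤ) ^ i * e i * ((n + (c + 2) - i).choose (c + 2 - i) : ℤ) ≤ h n)
    (hf : ∀ᶠ n in atTop, h n ≤ ∑ i ∈ Finset.range (c + 2 + 1),
      (-1 : ℤ) ^ i * e i * ((n + (c + 2) - i).choose (c + 2 - i) : ℤ) +
      ∑ i ∈ Finset.range (c + 2),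
        (-1 : ℤ) ^ i * f i * ((n + 1 + (c + 2 - 1) - i).choose (c + 2 - 1 - i) : ℤ)) :
    e 1 ≤ f 0 := by
  have hE : e 0 ≤ E := by
    have hl := tendsto_sum_choose_div_pow 0 (c + 2) fun i => (-1) ^ i * e i
    have hr := (tendsto_sum_choose_div_pow 0 (c + 2)
      fun i => if i = 0 then E else if i = 1 then K else 0)
    have hle := le_of_tendsto_of_tendsto hl hr ?_
    · have hpos : (0 : ℝ) < ((c + 2).factorial : ℝ) := by exact_mod_cast Nat.factorial_pos _
      rw [div_le_div_iff_of_pos_right hpos] at hle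
      simpa using hle
    · filter_upwards [hupp, he] with n h1 h2
      refine div_le_div_of_nonneg_right ?_ (by positivity)
      rw [Int.cast_le]
      refine h2.trans (h1.trans (le_of_eq ?_))
      rw [Finset.sum_range_succ', Finset.sum_range_succ']
      simp [add_comm]
  have hl := (tendsto_sum_choose_div_pow 0 (c + 1) fun i => (-1) ^ (i + 1) * e (i + 1)).add
    (tendsto_sum_choose_div_pow 1 (c + 1) fun i => (-1) ^ i * f i)
  have hge := ge_of_tendsto (b := 0) hl ?_
  · have hpos : (0 : ℝ) < ((c + 1).factorial : ℝ) := by exact_mod_cast Nat.factorial_pos _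
    rw [← add_div, le_div_iff₀ hpos, zero_mul] at hge
    have : (0 : ℤ) ≤ - e 1 + f 0 := by
      rw [← Int.cast_nonneg_iff (R := ℝ)]
      simpa using hge
    linarith
  · filter_upwards [hlow, hf] with n h1 h2
    rw [← add_div]
    refine div_nonneg ?_ (by positivity)
    rw [← Int.cast_add, Int.cast_nonneg_iff]
    have h3 := h1.trans h2
    rw [Finset.sum_range_succ'] at h3
    have h4 : e 0 * ((n + (c + 2)).choose (c + 2) : ℤ) ≤ E * ((n + (c + 2)).choose (c + 2) : ℤ) :=
      mul_le_mul_of_nonneg_right hE (Int.natCast_nonneg _)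
    have h5 : ∑ i ∈ Finset.range (c + 2), (-1 : ℤ) ^ (i + 1) * e (i + 1) *
        ((n + (c + 2) - (i + 1)).choose (c + 2 - (i + 1)) : ℤ) =
      ∑ i ∈ Finset.range (c + 1 + 1), (-1 : ℤ) ^ (i + 1) * e (i + 1) *
        ((n + 0 + (c + 1) - i).choose (c + 1 - i) : ℤ) := by
      refine Finset.sum_congr rfl fun i _ => ?_
      rw [show n + (c + 2) - (i + 1) = n + 0 + (c + 1) - i by omega,
        show c + 2 - (i + 1) = c + 1 - i by omega]
    rw [h5] at h3
    simp only [pow_zero, one_mul, Nat.sub_zero] at h3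
    change E * _ ≤ _ + ∑ i ∈ Finset.range (c + 1 + 1),
      (-1 : ℤ) ^ i * f i * ((n + 1 + (c + 1) - i).choose (c + 1 - i) : ℤ) at h3
    linarith

end Asymptotics

section ParameterIdeals

variable {A : Type*} [CommRing A] [IsLocalRing A]

lemma exists_radical_span_range_eq [IsNoetherianRing A] {d : ℕ} (hdim : ringKrullDim A = d) :
    ∃ z : Fin d → A, (Ideal.span (Set.range z)).radical = maximalIdeal A := by
  obtain ⟨s, hs, hcard⟩ :=
    Ideal.exists_finset_card_eq_height_of_isNoetherianRing (maximalIdeal A)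
  have h1 : ((maximalIdeal A).height : WithBot ℕ∞) = d := by
    rw [maximalIdeal_height_eq_ringKrullDim, hdim]
  have h2 : s.card = d := by
    rw [← hcard] at h1
    exact_mod_cast h1
  refine ⟨fun i => (s.equivFinOfCardEq h2).symm i, ?_⟩
  have hrange : Set.range (fun i => ((s.equivFinOfCardEq h2).symm i : A)) = s := by
    change Set.range (Subtype.val ∘ (s.equivFinOfCardEq h2).symm) = s
    rw [(s.equivFinOfCardEq h2).symm.surjective.range_comp, Subtype.range_coe]
  rw [hrange]
  refine le_antisymm ((Ideal.IsPrime.radical_le_iff inferInstance).mpr hs.1.2) ?_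
  rw [Ideal.radical_eq_sInf]
  exact le_sInf fun J hJ => hs.2 ⟨hJ.2, hJ.1⟩ (le_maximalIdeal hJ.2.ne_top)

lemma mul_pow_le_pow_of_mul_le {I q : Ideal A} (h : maximalIdeal A * I ≤ maximalIdeal A * q)
    (n : ℕ) : maximalIdeal A * I ^ n ≤ maximalIdeal A * q ^ n := by
  induction n with
  | zero => simp
  | succ n ih =>
    calc maximalIdeal A * I ^ (n + 1) = (maximalIdeal A * I ^ n) * I := by rw [pow_succ, mul_assoc]
      _ ≤ (maximalIdeal A * q ^ n) * I := Ideal.mul_mono_left ih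
      _ = (maximalIdeal A * I) * q ^ n := by ring
      _ ≤ (maximalIdeal A * q) * q ^ n := Ideal.mul_mono_left h
      _ = maximalIdeal A * q ^ (n + 1) := by rw [pow_succ', mul_assoc]

lemma length_quotient_le_add_length_colon {I q : Ideal A} (h : maximalIdeal A * I ≤ q) :
    Module.length A (A ⧸ q) ≤ Module.length A (A ⧸ I) + Module.length A
      (↥(q.colon (maximalIdeal A)) ⧸ Submodule.comap (q.colon (maximalIdeal A)).subtype q) := by
  rw [length_quotient_eq_add_of_sup_range (q.colon (maximalIdeal A)).subtype rfl]
  refine add_le_add (length_quotient_anti ?_) le_rfl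
  rw [Submodule.range_subtype]
  refine le_sup_of_le_right fun a ha => Submodule.mem_colon.mpr fun b hb => ?_
  rw [smul_eq_mul, mul_comm]
  exact h (Ideal.mul_mem_mul hb ha)

end ParameterIdeals

section Coefficients

open Filter

lemma moduleLength_eq_natCast_iff {A M : Type} [CommRing A] [AddCommGroup M] [Module A M] {L : ℕ} :
    moduleLength A M = ((L : ℕ∞) : WithBot ℕ∞) ↔ Module.length A M = L := by
  rw [moduleLength, ← Module.coe_length, WithBot.coe_inj]

variable {A : Type} [CommRing A] [IsLocalRing A]

lemma coeff_one_le_of_mul_colon_le [IsNoetherianRing A] {c : ℕ} {x : Fin (c + 2) → A}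
    (hx : (Ideal.span (Set.range x)).radical = maximalIdeal A)
    (hmul : maximalIdeal A * (Ideal.span (Set.range x)).colon (maximalIdeal A) ≤
      maximalIdeal A * Ideal.span (Set.range x)) {e f : ℕ → ℤ}
    (he : IsHilbertCoeffs A (c + 2) ((Ideal.span (Set.range x)).colon (maximalIdeal A)) e)
    (hf : IsIrrCoeffs A (c + 2) (Ideal.span (Set.range x)) f) : e 1 ≤ f 0 := by
  have hx' : ∃ s, maximalIdeal A ^ s ≤ Ideal.span (Set.range x) := by
    simpa only [hx] using
      Ideal.exists_radical_pow_le_of_fg (Ideal.span (Set.range x)) (IsNoetherian.noetherian _)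
  obtain ⟨E, K, hEK⟩ := exists_length_pow_bounds x hx'
  set q := Ideal.span (Set.range x)
  set I := q.colon (maximalIdeal A)
  have hqI : q ≤ I := fun a ha => Submodule.mem_colon.mpr fun b _ => Ideal.mul_mem_right _ _ ha
  have hfin (n : ℕ) : Module.length A (A ⧸ q ^ (n + 1)) ≠ ⊤ :=
    ne_top_of_le_ne_top (ENat.natCast_ne_top _) (hEK n).2
  choose h hh using fun n => ENat.ne_top_iff_exists.mp (hfin n)
  simp only [← hh, Nat.cast_le] at hEK
  obtain ⟨N₁, he⟩ := he
  obtain ⟨N₂, hf⟩ := hf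
  refine coeff_one_le_of_eventually_le (E := E) (K := K) (h := fun n => (h n : ℤ))
    (.of_forall fun n => mod_cast (hEK n).1) (.of_forall fun n => mod_cast (hEK n).2) ?_ ?_
  · filter_upwards [eventually_ge_atTop N₁] with n hn
    obtain ⟨L, hL, hLsum⟩ := he n hn
    rw [moduleLength_eq_natCast_iff] at hL
    rw [← hLsum, Nat.cast_le, ← Nat.cast_le (α := ℕ∞), ← hL, hh]
    exact length_quotient_anti (Ideal.pow_right_mono hqI _)
  · filter_upwards [eventually_ge_atTop N₁, eventually_ge_atTop N₂] with n hn₁ hn₂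
    obtain ⟨L₁, hL₁, hL₁sum⟩ := he n hn₁
    obtain ⟨L₂, hL₂, hL₂sum⟩ := hf (n + 1) (by omega)
    rw [indexOfReducibility] at hL₂
    rw [moduleLength_eq_natCast_iff] at hL₁ hL₂
    rw [← hL₁sum, ← hL₂sum, ← Nat.cast_add, Nat.cast_le, ← Nat.cast_le (α := ℕ∞), hh,
      Nat.cast_add, ← hL₁, ← hL₂]
    exact length_quotient_le_add_length_colon
      ((mul_pow_le_pow_of_mul_le hmul (n + 1)).trans Ideal.mul_le_right)

end Coefficients

/-- Corollary 2.4: for an unmixed Noetherian local ring of dimension `d ≥ 2` with infinite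
residue field, for every integer `n` there is a parameter ideal `𝔮 ⊆ 𝔪ⁿ` with
`e₁(𝔮:𝔪) ≤ f₀(𝔮)`. -/
theorem stmt_6 [IsNoetherianRing R] (d : ℕ)
    (hdim : ringKrullDim R = (d : WithBot ℕ∞)) (hd : 2 ≤ d)
    (hres : Infinite (ResidueField R)) (hunmixed : IsUnmixed R d) :
    ∀ n : ℕ, ∃ q : Ideal R, IsParameterIdeal R d q ∧ q ≤ maximalIdeal R ^ n ∧
      ∀ eI f : ℕ → ℤ, IsHilbertCoeffs R d (q.colon (maximalIdeal R)) eI →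
        IsIrrCoeffs R d q f → eI 1 ≤ f 0 := by
  intro n
  obtain ⟨c, rfl⟩ := Nat.exists_eq_add_of_le' hd
  obtain ⟨z, hz⟩ := exists_radical_span_range_eq hdim
  obtain ⟨s, hs⟩ := Ideal.exists_radical_pow_le_of_fg (Ideal.span (Set.range z))
    (IsNoetherian.noetherian _)
  rw [hz] at hs
  obtain ⟨N, hnN, hN⟩ : ∃ N, n ≤ N ∧ (c + 2).factorial * (s * ((c + 2) * N)) < N ^ (c + 2) := by
    set k := (c + 2).factorial * s * (c + 2) with hk
    refine ⟨k + n + 1, by omega, ?_⟩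
    have h1 : (k + n + 1) ^ 2 ≤ (k + n + 1) ^ (c + 2) :=
      Nat.pow_le_pow_right (Nat.succ_pos _) (by omega)
    refine lt_of_lt_of_le ?_ h1
    calc _ = k * (k + n + 1) := by rw [hk]; ring
      _ < (k + n + 1) ^ 2 := by nlinarith
  have hN0 : N ≠ 0 := fun h0 => by simp [h0] at hN
  have hzm (i : Fin (c + 2)) : z i ∈ maximalIdeal R :=
    hz ▸ Ideal.le_radical (Ideal.subset_span (Set.mem_range_self i))
  have hqm (k : ℕ) (hk : k ≤ N) :
      Ideal.span (Set.range fun i => z i ^ N) ≤ maximalIdeal R ^ k := by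
    rw [Ideal.span_le]
    rintro _ ⟨i, rfl⟩
    exact Ideal.pow_le_pow_right hk (Ideal.pow_mem_pow (hzm i) N)
  have hrad : (Ideal.span (Set.range fun i => z i ^ N)).radical = maximalIdeal R := by
    refine le_antisymm ((Ideal.IsPrime.radical_le_iff inferInstance).mpr ?_) ?_
    · simpa using hqm 1 (Nat.one_le_iff_ne_zero.mpr hN0)
    · rw [← hz, Ideal.radical_le_radical_iff, Ideal.span_le]
      rintro _ ⟨i, rfl⟩
      exact ⟨N, Ideal.subset_span ⟨i, rfl⟩⟩
  refine ⟨_, ⟨⟨fun i => z i ^ N, rfl⟩, hrad⟩, hqm n hnN, fun e f he hf => ?_⟩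
  refine coeff_one_le_of_mul_colon_le hrad (Ideal.mul_le.mpr fun a ha y hy => ?_) he hf
  refine mul_mem_maximalIdeal_mul_span_pow hdim hz hs hN ha fun b hb => ?_
  rw [mul_comm]
  exact Submodule.mem_colon.mp hy b hb

end
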